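/- arXiv:2203.14131 — 2 statements merged into one kernel-verified Lean document; each statement's English description precedes it below -/
import Mathlib

section
/- Let L/K be a finite Galois extension of number fields of odd degree, with group G = Gal(L/K), and let D_{L/K} denote the different ideal of the extension of rings of integers O_K ⊆ O_L. Then there exists a unique fractional ideal A_{L/K} of O_L such that (A_{L/K})² = (D_{L/K})⁻¹ as fractional ideals of L; moreover, A_{L/K} is stable under the action of G on fractional ideals of L. -/
open NumberField
open scoped nonZeroDivisors

open IsDedekindDomain in
theorem Ideal.exists_sq_eq_of_even_multiplicity {R : Type*} [CommRing R] [IsDedekindDomain R]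
    {I : Ideal R} (hI : I ≠ ⊥)
    (h : ∀ v : HeightOneSpectrum R, Even (multiplicity v.asIdeal I)) :
    ∃ J : Ideal R, J ^ 2 = I := by
  refine ⟨∏ᶠ v : HeightOneSpectrum R, v.asIdeal ^ (multiplicity v.asIdeal I / 2), ?_⟩
  have hfin := Ideal.hasFiniteMulSupport (R := R) hI
  rw [finprod_pow]
  · conv_rhs => rw [← Ideal.finprod_heightOneSpectrum_pow_multiplicity hI]
    refine finprod_congr fun v => ?_
    rw [← pow_mul, Nat.div_mul_cancel (h v).two_dvd]
  · refine hfin.subset fun v hv => ?_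
    simp only [Function.mem_mulSupport] at hv ⊢
    contrapose! hv
    rw [HeightOneSpectrum.maxPowDividing_eq_pow_multiplicity hI] at hv
    have : multiplicity v.asIdeal I = 0 := by
      by_contra h0
      exact v.isPrime.ne_top (Ideal.isUnit_iff.mp ((isUnit_pow_iff h0).mp (hv ▸ isUnit_one)))
    simp [this]

theorem FractionalIdeal.sq_injective {R K : Type*} [CommRing R] [IsDedekindDomain R] [Field K]
    [Algebra R K] [IsFractionRing R K] :
    Function.Injective fun I : FractionalIdeal R⁰ K => I ^ 2 := by
  intro I J h
  simp only at h
  by_cases hI : I = 0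
  · subst hI
    simpa [eq_comm] using h
  have hJ : J ≠ 0 := by
    rintro rfl
    simp [hI] at h
  rw [← finprod_heightOneSpectrum_factorization' K hI,
    ← finprod_heightOneSpectrum_factorization' K hJ]
  refine finprod_congr fun v => ?_
  have := congrArg (count K v) h
  rw [count_pow, count_pow] at this
  congr 1
  push_cast at this
  linarith

theorem Finset.multiplicity_prod_of_finiteMultiplicity {α ι : Type*} [CommMonoidWithZero α]
    [IsCancelMulZero α] {p : α} (hp : Prime p) (s : Finset ι) (f : ι → α)
    (h : FiniteMultiplicity p (∏ i ∈ s, f i)) :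
    multiplicity p (∏ i ∈ s, f i) = ∑ i ∈ s, multiplicity p (f i) := by
  have hf : ∀ i ∈ s, FiniteMultiplicity p (f i) := fun i hi =>
    let ⟨n, hn⟩ := h
    ⟨n, fun hd => hn (hd.trans (Finset.dvd_prod_of_mem f hi))⟩
  have := Finset.emultiplicity_prod hp s f
  rw [h.emultiplicity_eq_multiplicity,
    Finset.sum_congr rfl fun i hi => (hf i hi).emultiplicity_eq_multiplicity] at this
  exact_mod_cast this

theorem Finset.even_sum_of_inv {G : Type*} [Group G] [Fintype G] [DecidableEq G]
    (hG : Odd (Nat.card G)) (f : G → ℕ) (hf : ∀ g, f g⁻¹ = f g) :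
    Even (∑ g ∈ Finset.univ.erase 1, f g) := by
  rw [← ZMod.natCast_eq_zero_iff_even, Nat.cast_sum]
  refine Finset.sum_involution (fun g _ => g⁻¹) ?_ ?_ ?_ ?_
  · intro g _
    rw [hf]
    exact CharTwo.add_self_eq_zero _
  · intro g hg _ h
    have h2 : g ^ 2 = 1 := by rw [pow_two]; nth_rw 1 [← h]; simp
    have h3 := orderOf_dvd_of_pow_eq_one h2
    have h4 : orderOf g = 1 := by
      refine Nat.eq_one_of_dvd_coprimes ?_ (orderOf_dvd_natCard g) h3
      exact hG.coprime_two_right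
    exact (Finset.mem_erase.mp hg).1 (orderOf_eq_one_iff.mp h4)
  · intro g hg
    simpa using hg
  · simp

/-- If `A[x]` surjects onto the residue field at `P`, contains a uniformizer at `P`, and `x` lies in
all primes over `P ∩ A` except `P`, then `P` does not contain the conductor of `A[x]`. -/
theorem conductor_not_le_of_generates_residue {A B : Type*} [CommRing A] [CommRing B]
    [IsDedekindDomain B] [Algebra A B] [Module.Finite A B] {P : Ideal B} [P.IsPrime] {x : B}
    (hres : ∀ y, ∃ c ∈ Algebra.adjoin A {x}, y - c ∈ P)
    (hunif : ∃ c ∈ Algebra.adjoin A {x}, c ∈ P ∧ c ∉ P ^ 2) (hxP : x ∉ P)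
    (hx : ∀ Q : Ideal B, Q.IsPrime → Q.under A = P.under A → Q ≠ P → x ∈ Q) :
    ¬ conductor A x ≤ P := by
  obtain ⟨u, huC, huP, huP2⟩ := hunif
  have hP0 : P ≠ ⊥ := by
    rintro rfl
    exact huP2 (by simp_all)
  have hPm : P.IsMaximal := Ideal.IsPrime.isMaximal inferInstance hP0
  let C := Algebra.adjoin A {x}
  let q : Ideal C := P.under C
  have : Algebra.IsIntegral C B := Algebra.IsIntegral.tower_top (R := A)
  have : Module.Finite C B := Module.Finite.of_restrictScalars_finite A C B
  have hqm : q.IsMaximal := Ideal.isMaximal_comap_of_isIntegral_of_isMaximal P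
  have hqP : q.map (algebraMap C B) ≤ P := Ideal.map_comap_le
  have hqeq : q.map (algebraMap C B) = P := by
    obtain ⟨J, hJ⟩ := Ideal.dvd_iff_le.mpr hqP
    suffices J = ⊤ by rw [hJ, this, Ideal.mul_top]
    by_contra hJt
    obtain ⟨Q, hQm, hJQ⟩ := Ideal.exists_le_maximal J hJt
    have hu : u ∈ P * J := by
      rw [← hJ]
      exact Ideal.mem_map_of_mem (algebraMap C B) (show (⟨u, huC⟩ : C) ∈ q from huP)
    by_cases hQP : Q = P
    · subst hQP
      exact huP2 (by rw [pow_two]; exact Ideal.mul_mono_right hJQ hu)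
    · have hqQ : q ≤ Q.under C := by
        refine Ideal.map_le_iff_le_comap.mp ?_
        rw [hJ]
        exact Ideal.mul_le_right.trans hJQ
      have hqQ' : q = Q.under C := hqm.eq_of_le (Ideal.IsPrime.ne_top inferInstance) hqQ
      have : Q.under A = P.under A := by
        rw [← Ideal.under_under (B := C) Q, ← Ideal.under_under (B := C) P, ← hqQ']
      have hxQ := hx Q hQm.isPrime this hQP
      have : (⟨x, Algebra.self_mem_adjoin_singleton A x⟩ : C) ∈ q := by
        rw [hqQ']; exact hxQ
      exact hxP this
  let N : Submodule C B := LinearMap.range (Algebra.linearMap C B)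
  obtain ⟨r, hr1, hr⟩ := Submodule.exists_sub_one_mem_and_smul_eq_zero_of_fg_of_le_smul q
    (⊤ : Submodule C (B ⧸ N)) Module.Finite.fg_top (by
      rintro y -
      obtain ⟨y, rfl⟩ := N.mkQ_surjective y
      obtain ⟨c, hc, hyc⟩ := hres y
      have h1 : N.mkQ y = N.mkQ (y - c) := by
        rw [map_sub, eq_comm, sub_eq_self]
        simpa using show c ∈ N from ⟨⟨c, hc⟩, rfl⟩
      have h2 : y - c ∈ q • (⊤ : Submodule C B) := by
        rw [Ideal.smul_top_eq_map, hqeq]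
        exact hyc
      rw [h1]
      have := Submodule.mem_map_of_mem (f := N.mkQ) h2
      rw [Submodule.map_smul''] at this
      exact Submodule.smul_mono le_rfl le_top this)
  intro hle
  have hrc : (r : B) ∈ conductor A x := by
    intro b
    have := hr (N.mkQ b) trivial
    rw [← map_smul, Submodule.mkQ_apply, Submodule.Quotient.mk_eq_zero] at this
    obtain ⟨c, hc⟩ := this
    change (r : B) * b ∈ C
    rw [Algebra.smul_def] at hc
    exact hc ▸ c.2
  have hrq : r ∈ q := hle hrc
  exact hqm.ne_top ((Ideal.eq_top_iff_one q).mpr (by simpa using sub_mem hrq hr1))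

theorem Ideal.exists_mem_generates_residue (A : Type*) {B : Type*} [CommRing A] [CommRing B]
    [IsDedekindDomain B] [Algebra A B] {P J : Ideal B} [P.IsPrime] [Finite (B ⧸ P)] (hP : P ≠ ⊥)
    (hJ : ¬ J ≤ P) :
    ∃ x ∈ J, x ∉ P ∧ (∀ y, ∃ c ∈ Algebra.adjoin A {x}, y - c ∈ P) ∧
      ∃ c ∈ Algebra.adjoin A {x}, c ∈ P ∧ c ∉ P ^ 2 := by
  have hPm : P.IsMaximal := Ideal.IsPrime.isMaximal inferInstance hP
  let := Ideal.Quotient.field P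
  have := Fintype.ofFinite (B ⧸ P)
  let N := Fintype.card (B ⧸ P)
  obtain ⟨g, hg⟩ := IsCyclic.exists_generator (α := (B ⧸ P)ˣ)
  obtain ⟨a, ha⟩ := Ideal.Quotient.mk_surjective (g : B ⧸ P)
  have hNP : (N : B) ∈ P := by
    rw [← Ideal.Quotient.eq_zero_iff_mem, map_natCast]
    exact FiniteField.cast_card_eq_zero _
  have hlt : P ^ 2 < P := by
    simpa using Ideal.pow_right_strictAnti P hP hPm.ne_top one_lt_two
  obtain ⟨π, hπ, hπ2⟩ := SetLike.exists_of_lt hlt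
  obtain ⟨b, hba, hb⟩ : ∃ b, b - a ∈ P ∧ b ^ N - b ∉ P ^ 2 := by
    by_cases h : a ^ N - a ∈ P ^ 2
    · refine ⟨a + π, by simpa using hπ, fun h' => hπ2 ?_⟩
      obtain ⟨k, hk⟩ := Polynomial.powAddExpansion a π N
      rw [hk] at h'
      have h1 : (N : B) * π ∈ P ^ 2 := by
        rw [pow_two]; exact Ideal.mul_mem_mul hNP hπ
      have h2 : π ^ 2 ∈ P ^ 2 := Ideal.pow_mem_pow hπ 2
      have : π = (a ^ N - a) - (a ^ N + N * a ^ (N - 1) * π + k * π ^ 2 - (a + π))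
          + a ^ (N - 1) * (N * π) + k * π ^ 2 := by ring
      rw [this]
      exact add_mem (add_mem (sub_mem h h') (Ideal.mul_mem_left _ _ h1)) (Ideal.mul_mem_left _ _ h2)
    · exact ⟨a, by simp, h⟩
  have hcop : IsCoprime (P ^ 2) J := by
    refine IsCoprime.pow_left ?_
    rw [Ideal.isCoprime_iff_sup_eq]
    exact hPm.1.2 _ (left_lt_sup.mpr hJ)
  obtain ⟨i, hi, j, hj, hij⟩ := Ideal.isCoprime_iff_exists.mp hcop
  have hxb : b * j - b ∈ P ^ 2 := by
    have : b * j - b = -b * i := by linear_combination b * hij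
    rw [this]
    exact Ideal.mul_mem_left _ _ hi
  have hmk : Ideal.Quotient.mk P (b * j) = g := by
    rw [← ha, Ideal.Quotient.mk_eq_mk_iff_sub_mem]
    simpa using add_mem (hlt.le hxb) hba
  set x := b * j with hx
  have hxC : x ∈ Algebra.adjoin A {x} := Algebra.self_mem_adjoin_singleton A x
  refine ⟨x, Ideal.mul_mem_left _ _ hj, ?_, fun y => ?_, x ^ N - x,
    sub_mem (pow_mem hxC _) hxC, ?_, fun h => hb ?_⟩
  · rw [← Ideal.Quotient.eq_zero_iff_mem, hmk]
    exact g.ne_zero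
  · by_cases hy : y ∈ P
    · exact ⟨0, zero_mem _, by simpa using hy⟩
    · have hy' : Ideal.Quotient.mk P y ≠ 0 := by rwa [Ne, Ideal.Quotient.eq_zero_iff_mem]
      obtain ⟨n, hn⟩ := mem_powers_iff_mem_zpowers.mpr (hg (Units.mk0 _ hy'))
      refine ⟨x ^ n, pow_mem hxC _, ?_⟩
      rw [← Ideal.Quotient.mk_eq_mk_iff_sub_mem, map_pow, hmk]
      simpa using (congrArg Units.val hn).symm
  · rw [← Ideal.Quotient.eq_zero_iff_mem, map_sub, map_pow, FiniteField.pow_card, sub_self]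
  · have h1 : x ^ N - b ^ N ∈ P ^ 2 := by
      obtain ⟨k, hk⟩ := sub_dvd_pow_sub_pow x b N
      rw [hk]
      exact Ideal.mul_mem_right _ _ hxb
    have : b ^ N - b = (x ^ N - x) - (x ^ N - b ^ N) + (x - b) := by ring
    rw [this]
    exact add_mem (sub_mem h h1) hxb

theorem Ideal.exists_generator_away_from_conductor (A : Type*) {B : Type*} [CommRing A]
    [CommRing B] [IsDomain A] [IsDedekindDomain B] [Algebra A B] [Module.IsTorsionFree A B]
    [Module.Finite A B] {P : Ideal B} [P.IsPrime] [Finite (B ⧸ P)] (hP : P ≠ ⊥) :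
    ∃ x : B, ¬ conductor A x ≤ P ∧ x ∉ P ∧
      ∀ Q : Ideal B, Q.IsPrime → Q.under A = P.under A → Q ≠ P → x ∈ Q := by
  let I := (P.under A).map (algebraMap A B)
  have hI : I ≠ ⊥ := by
    have h := Ideal.IsIntegral.comap_ne_bot A hP
    rwa [Ne, Ideal.map_eq_bot_iff_of_injective (FaithfulSMul.algebraMap_injective A B)]
  have hPp : Prime P := Ideal.prime_of_isPrime hP inferInstance
  obtain ⟨J, hJ, hJP⟩ :=
    (FiniteMultiplicity.of_prime_left hPp hI).exists_eq_pow_mul_and_not_dvd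
  rw [Ideal.dvd_iff_le] at hJP
  obtain ⟨x, hxJ, hxP, hres, hunif⟩ := Ideal.exists_mem_generates_residue A hP hJP
  have hx : ∀ Q : Ideal B, Q.IsPrime → Q.under A = P.under A → Q ≠ P → x ∈ Q := by
    intro Q hQ hQP hne
    have hIQ : I ≤ Q := by
      rw [Ideal.map_le_iff_le_comap]
      exact hQP.ge
    rw [hJ, hQ.mul_le] at hIQ
    refine hIQ.resolve_left (fun h => hne ?_) hxJ
    exact ((Ideal.IsPrime.isMaximal inferInstance hP).eq_of_le hQ.ne_top
      (hQ.le_of_pow_le h)).symm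
  exact ⟨x, conductor_not_le_of_generates_residue hres hunif hxP hx, hxP, hx⟩

open Polynomial in
/-- The different of a primitive element is the product of its differences with its other conjugates. -/
theorem IsGalois.aeval_derivative_minpoly_eq_prod {K L : Type*} [Field K] [Field L] [Algebra K L]
    [FiniteDimensional K L] [IsGalois K L] [DecidableEq (L ≃ₐ[K] L)] {x : L}
    (hx : Algebra.adjoin K {x} = ⊤) :
    aeval x (derivative (minpoly K x)) = ∏ σ ∈ Finset.univ.erase (1 : L ≃ₐ[K] L), (x - σ x) := by
  have hint : IsIntegral K x := Algebra.IsIntegral.isIntegral x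
  have hinj : Function.Injective fun σ : L ≃ₐ[K] L => σ x := by
    intro σ τ h
    have : (σ : L →ₐ[K] L) = τ := AlgHom.ext_of_adjoin_eq_top hx (by simpa using h)
    exact AlgEquiv.coe_toAlgHom_injective this
  have hmin : (minpoly K x).map (algebraMap K L) = ∏ σ : L ≃ₐ[K] L, (X - C (σ x)) := by
    refine (eq_of_monic_of_dvd_of_natDegree_le (monic_prod_of_monic _ _ fun _ _ => monic_X_sub_C _)
      ((minpoly.monic hint).map _) (Finset.prod_dvd_of_coprime ?_ ?_) ?_)
    · exact (pairwise_coprime_X_sub_C hinj).set_pairwise _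
    · intro σ _
      rw [dvd_iff_isRoot, IsRoot, eval_map_algebraMap, aeval_algHom_apply, minpoly.aeval, map_zero]
    · rw [natDegree_map, natDegree_prod_of_monic _ _ fun _ _ => monic_X_sub_C _]
      simp only [natDegree_X_sub_C, Finset.sum_const, Finset.card_univ, smul_eq_mul, mul_one]
      rw [← Nat.card_eq_fintype_card, IsGalois.card_aut_eq_finrank]
      exact minpoly.natDegree_le x
  rw [← eval_map_algebraMap, ← derivative_map, hmin,
    ← Finset.mul_prod_erase _ _ (Finset.mem_univ 1), derivative_mul]
  simp [eval_prod]

theorem adjoin_eq_top_of_conductor_ne_bot {A K B L : Type*} [CommRing A] [Field K] [CommRing B]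
    [Field L] [Algebra A K] [Algebra A B] [Algebra A L] [Algebra K L] [Algebra B L]
    [IsScalarTower A K L] [IsScalarTower A B L] [IsFractionRing B L] [Algebra.IsAlgebraic K L]
    {x : B} (hx : conductor A x ≠ ⊥) : Algebra.adjoin K {algebraMap B L x} = ⊤ := by
  have hmem : ∀ c ∈ Algebra.adjoin A {x},
      algebraMap B L c ∈ IntermediateField.adjoin K {algebraMap B L x} := by
    intro c hc
    induction hc using Algebra.adjoin_induction with
    | mem y hy =>
      rw [Set.mem_singleton_iff.mp hy]
      exact IntermediateField.mem_adjoin_simple_self K _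
    | algebraMap a =>
      rw [← IsScalarTower.algebraMap_apply, IsScalarTower.algebraMap_apply A K L]
      exact IntermediateField.algebraMap_mem _ _
    | add y z _ _ hy hz => rw [map_add]; exact add_mem hy hz
    | mul y z _ _ hy hz => rw [map_mul]; exact mul_mem hy hz
  obtain ⟨r, hr, hr0⟩ := Submodule.exists_mem_ne_zero_of_ne_bot hx
  have hr0' : algebraMap B L r ≠ 0 := by simpa using hr0
  rw [← IntermediateField.adjoin_simple_toSubalgebra_of_isAlgebraic
    (Algebra.IsAlgebraic.isAlgebraic _), eq_top_iff]
  rintro y -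
  rw [IntermediateField.mem_toSubalgebra]
  obtain ⟨b, d, hd, rfl⟩ := IsFractionRing.div_surjective (A := B) y
  have : algebraMap B L b / algebraMap B L d = algebraMap B L (r * b) / algebraMap B L (r * d) := by
    rw [map_mul, map_mul, mul_div_mul_left _ _ hr0']
  rw [this]
  exact div_mem (hmem _ (hr b)) (hmem _ (hr d))

open scoped Pointwise in
open IsDedekindDomain in
/-- In a Galois extension of odd degree every prime divides the different to an even power: the
factors `x - σ x` and `x - σ⁻¹ x` of `f'(x)` have the same multiplicity. -/
theorem even_multiplicity_differentIdeal (K L : Type*) [Field K] [NumberField K] [Field L]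
    [NumberField L] [Algebra K L] [IsGalois K L] (hodd : Odd (Module.finrank K L))
    (v : HeightOneSpectrum (𝓞 L)) :
    Even (multiplicity v.asIdeal (differentIdeal (𝓞 K) (𝓞 L))) := by
  classical
  set P := v.asIdeal
  have hP : P ≠ ⊥ := v.ne_bot
  have hPp : Prime P := v.prime
  have : Finite (𝓞 L ⧸ P) := Ideal.finiteQuotientOfFreeOfNeBot P hP
  obtain ⟨x, hcond, hxP, hx⟩ := Ideal.exists_generator_away_from_conductor (𝓞 K) hP
  have hadj : Algebra.adjoin K {algebraMap (𝓞 L) L x} = ⊤ :=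
    adjoin_eq_top_of_conductor_ne_bot (A := 𝓞 K) (x := x) fun h => hcond (h ▸ bot_le)
  have hprod : Polynomial.aeval x (Polynomial.derivative (minpoly (𝓞 K) x)) =
      ∏ σ ∈ Finset.univ.erase (1 : L ≃ₐ[K] L), (x - σ • x) := by
    apply FaithfulSMul.algebraMap_injective (𝓞 L) L
    rw [← Polynomial.aeval_algebraMap_apply, map_prod]
    simp only [map_sub]
    refine Eq.trans ?_ (IsGalois.aeval_derivative_minpoly_eq_prod hadj)
    rw [minpoly.isIntegrallyClosed_eq_field_fractions K L (Algebra.IsIntegral.isIntegral (R := 𝓞 K) x),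
      Polynomial.derivative_map, Polynomial.aeval_map_algebraMap]
  have hD := conductor_mul_differentIdeal (𝓞 K) K L x hadj
  rw [hprod, ← Ideal.prod_span_singleton] at hD
  have hD0 : differentIdeal (𝓞 K) (𝓞 L) ≠ ⊥ := differentIdeal_ne_bot
  have hc0 : conductor (𝓞 K) x ≠ ⊥ := fun h => hcond (h ▸ bot_le)
  have hfin : FiniteMultiplicity P (conductor (𝓞 K) x * differentIdeal (𝓞 K) (𝓞 L)) :=
    FiniteMultiplicity.of_prime_left hPp (mul_ne_zero hc0 hD0)
  have hmul := multiplicity_mul hPp hfin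
  rw [(multiplicity_eq_zero (b := conductor (𝓞 K) x)).mpr (by rwa [Ideal.dvd_iff_le]), zero_add, hD,
    Finset.multiplicity_prod_of_finiteMultiplicity hPp _ _ (hD ▸ hfin)] at hmul
  rw [← hmul]
  refine Finset.even_sum_of_inv (by rwa [IsGalois.card_aut_eq_finrank]) _ fun σ => ?_
  by_cases hσ : σ • P = P
  · have : Ideal.span {x - σ • x} = σ • Ideal.span {x - σ⁻¹ • x} := by
      rw [Ideal.pointwise_smul_def, Ideal.map_span, Set.image_singleton,
        ← Ideal.span_singleton_neg]
      simp [smul_sub]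
    rw [this]
    nth_rw 2 [← hσ]
    refine (multiplicity_eq_of_emultiplicity_eq ?_).symm
    rw [emultiplicity_eq_emultiplicity_iff]
    intro n
    rw [Ideal.dvd_iff_le, Ideal.dvd_iff_le, ← smul_pow', Ideal.pointwise_smul_le_pointwise_smul_iff]
  · have key : ∀ τ : L ≃ₐ[K] L, τ • P ≠ P → multiplicity P (Ideal.span {x - τ⁻¹ • x}) = 0 := by
      intro τ hτ
      rw [multiplicity_eq_zero, Ideal.dvd_span_singleton]
      intro h
      have h1 : x ∈ τ • P := hx _ inferInstance (Ideal.under_smul (𝓞 K) P τ) hτ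
      rw [Ideal.mem_pointwise_smul_iff_inv_smul_mem] at h1
      exact hxP (by simpa using add_mem h h1)
    rw [key σ hσ]
    have := key σ⁻¹ (by rwa [Ne, inv_smul_eq_iff, eq_comm])
    simpa using this.symm

theorem FractionalIdeal.map_mem_inv {K R L : Type*} [CommSemiring K] [CommRing R]
    [IsDedekindDomain R] [Field L] [Algebra K L] [Algebra R L] [IsFractionRing R L]
    {I : FractionalIdeal R⁰ L}
    (hI0 : I ≠ 0) (σ : L ≃ₐ[K] L) (hσ : ∀ y ∈ (1 : FractionalIdeal R⁰ L), σ y ∈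
      (1 : FractionalIdeal R⁰ L)) (hI : ∀ y ∈ I, σ.symm y ∈ I) :
    ∀ y ∈ I⁻¹, σ y ∈ I⁻¹ := by
  intro y hy
  rw [mem_inv_iff hI0] at hy ⊢
  intro z hz
  have := hσ _ (hy _ (hI z hz))
  rwa [map_mul, AlgEquiv.apply_symm_apply] at this

open scoped Pointwise in
theorem smul_differentIdeal (K L : Type*) [Field K] [NumberField K] [Field L]
    [NumberField L] [Algebra K L] [IsGalois K L] (σ : L ≃ₐ[K] L) :
    σ • differentIdeal (𝓞 K) (𝓞 L) = differentIdeal (𝓞 K) (𝓞 L) := by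
  suffices h : ∀ τ : L ≃ₐ[K] L, differentIdeal (𝓞 K) (𝓞 L) ≤ τ • differentIdeal (𝓞 K) (𝓞 L) by
    refine le_antisymm ?_ (h σ)
    have := h σ⁻¹
    rwa [Ideal.subset_pointwise_smul_iff, inv_inv] at this
  intro τ y hy
  rw [Ideal.mem_pointwise_smul_iff_inv_smul_mem]
  have hmem : ∀ y : 𝓞 L, y ∈ differentIdeal (𝓞 K) (𝓞 L) ↔
      (y : L) ∈ (FractionalIdeal.dual (𝓞 K) K (1 : FractionalIdeal (𝓞 L)⁰ L))⁻¹ := by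
    intro y
    rw [← coeIdeal_differentIdeal]
    simp [FractionalIdeal.mem_coeIdeal]
  have hone : ∀ (ρ : L ≃ₐ[K] L), ∀ y ∈ (1 : FractionalIdeal (𝓞 L)⁰ L),
      ρ y ∈ (1 : FractionalIdeal (𝓞 L)⁰ L) := by
    intro ρ y hy
    rw [FractionalIdeal.mem_one_iff] at hy ⊢
    obtain ⟨z, rfl⟩ := hy
    exact ⟨ρ • z, rfl⟩
  rw [hmem] at hy ⊢
  refine FractionalIdeal.map_mem_inv ?_ τ⁻¹ (hone _) ?_ _ hy
  · exact FractionalIdeal.dual_ne_zero (𝓞 K) K (one_ne_zero (α := FractionalIdeal (𝓞 L)⁰ L))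
  · intro z hz
    rw [FractionalIdeal.mem_dual (one_ne_zero (α := FractionalIdeal (𝓞 L)⁰ L))] at hz ⊢
    intro a ha
    have := hz _ (hone τ⁻¹ a ha)
    rw [Algebra.traceForm_apply] at this ⊢
    rw [← Algebra.trace_eq_of_algEquiv τ⁻¹]
    rwa [map_mul, AlgEquiv.apply_symm_apply]

open scoped Pointwise in
/-- For a finite Galois extension `L/K` of number fields of odd degree,
there is a unique fractional ideal `A` of `𝓞 L` with `A ^ 2 = (𝔇_{L/K})⁻¹`, and this `A`
is stable under the action of `Gal(L/K)`. -/
theorem square_root_of_inverse_different_exists_unique_and_galois_stable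
    (K L : Type) [Field K] [NumberField K] [Field L] [NumberField L]
    [Algebra K L] [IsGalois K L] (hodd : Odd (Module.finrank K L)) :
    ∃ A : FractionalIdeal (𝓞 L)⁰ L,
      A ^ 2 = (differentIdeal (𝓞 K) (𝓞 L) : FractionalIdeal (𝓞 L)⁰ L)⁻¹ ∧
      (∀ B : FractionalIdeal (𝓞 L)⁰ L,
        B ^ 2 = (differentIdeal (𝓞 K) (𝓞 L) : FractionalIdeal (𝓞 L)⁰ L)⁻¹ → B = A) ∧
      ∀ σ : L ≃ₐ[K] L,
        σ '' ((A : Submodule (𝓞 L) L) : Set L) = ((A : Submodule (𝓞 L) L) : Set L) := by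
  have hD0 : differentIdeal (𝓞 K) (𝓞 L) ≠ ⊥ := differentIdeal_ne_bot
  obtain ⟨J, hJ⟩ := Ideal.exists_sq_eq_of_even_multiplicity hD0
    (even_multiplicity_differentIdeal K L hodd)
  have hJ0 : J ≠ ⊥ := by
    rintro rfl
    exact hD0 (by rw [← hJ]; simp)
  have hA : (J : FractionalIdeal (𝓞 L)⁰ L)⁻¹ ^ 2 =
      (differentIdeal (𝓞 K) (𝓞 L) : FractionalIdeal (𝓞 L)⁰ L)⁻¹ := by
    rw [inv_pow, ← FractionalIdeal.coeIdeal_pow, hJ]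
  refine ⟨(J : FractionalIdeal (𝓞 L)⁰ L)⁻¹, hA,
    fun B hB => FractionalIdeal.sq_injective (hB.trans hA.symm), ?_⟩
  have hJσ : ∀ σ : L ≃ₐ[K] L, σ • J = J := by
    intro σ
    apply FractionalIdeal.coeIdeal_injective (K := L)
    apply FractionalIdeal.sq_injective
    simp only [← FractionalIdeal.coeIdeal_pow]
    rw [← smul_pow', hJ, smul_differentIdeal]
  have hle : ∀ σ : L ≃ₐ[K] L, ∀ y ∈ (J : FractionalIdeal (𝓞 L)⁰ L)⁻¹,
      σ y ∈ (J : FractionalIdeal (𝓞 L)⁰ L)⁻¹ := by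
    intro σ
    refine FractionalIdeal.map_mem_inv (by simpa using hJ0) σ ?_ ?_
    · intro y hy
      rw [FractionalIdeal.mem_one_iff] at hy ⊢
      obtain ⟨z, rfl⟩ := hy
      exact ⟨σ • z, rfl⟩
    · intro y hy
      rw [FractionalIdeal.mem_coeIdeal] at hy ⊢
      obtain ⟨z, hz, rfl⟩ := hy
      refine ⟨σ⁻¹ • z, ?_, rfl⟩
      rw [← hJσ σ⁻¹]
      exact Ideal.smul_mem_pointwise_smul _ _ _ hz
  intro σ
  refine Set.Subset.antisymm ?_ fun y hy => ⟨σ⁻¹ y, hle _ _ hy, by simp⟩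
  rintro _ ⟨y, hy, rfl⟩
  exact hle _ _ hy
end

section
/- Let p be a prime and let E/F be a finite Galois extension of p-adic fields of odd degree. Then the valuation v_E(D_{E/F}) of the different ideal D_{E/F} of O_E over O_F is even; equivalently, there exists a (unique) fractional ideal A of O_E with A² = (D_{E/F})⁻¹. -/
open scoped nonZeroDivisors

set_option synthInstance.maxHeartbeats 1000000
set_option maxHeartbeats 1000000

section Discriminant

variable {A K L B : Type*} [CommRing A] [Field K] [Field L] [CommRing B]
  [Algebra A K] [Algebra K L] [Algebra A L] [IsScalarTower A K L] [IsFractionRing A K]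
  [Algebra A B] [Algebra B L] [IsScalarTower A B L] [IsIntegralClosure B A L]
  [IsDomain A] [IsPrincipalIdealRing A] [FiniteDimensional K L] [IsGalois K L]

/-- If the dual of `B` under the trace form is `δ⁻¹ B`, then the product of the Galois conjugates
of `δ` is associated to the square of the determinant of the conjugates of an `A`-basis of `B`. -/
theorem associated_prod_galRestrict_sq [IsDedekindDomain B] [IsFractionRing B L]
    [Module.IsTorsionFree A B] {δ : B}
    (hδ : differentIdeal A B = Ideal.span {δ}) :
    ∃ P : B, P ≠ 0 ∧ Associated (∏ σ : Gal(L/K), galRestrict A K L B σ δ) (P ^ 2) := by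
  classical
  have : Module.Free A B :=
    have : Module.IsTorsionFree A L := .trans_faithfulSMul A K L
    IsIntegralClosure.module_free A K L B
  have : Module.Finite A B := IsIntegralClosure.finite A K L B
  have : IsLocalization (Algebra.algebraMapSubmonoid B A⁰) L :=
    IsIntegralClosure.isLocalization A K L B
  have hinj : Function.Injective (algebraMap B L) := FaithfulSMul.algebraMap_injective B L
  have hinjA : Function.Injective (algebraMap A K) := FaithfulSMul.algebraMap_injective A K
  have hcard : Module.finrank A B = Fintype.card Gal(L/K) := by
    have : Module.IsTorsionFree A L := .trans_faithfulSMul A K L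
    rw [IsIntegralClosure.rank A K L B, ← Nat.card_eq_fintype_card,
      IsGalois.card_aut_eq_finrank]
  let b₀ : Module.Basis Gal(L/K) A B :=
    (Module.finBasis A B).reindex (Fintype.equivOfCardEq (by simpa using hcard))
  let b : Module.Basis Gal(L/K) K L := b₀.localizationLocalization K A⁰ L
  have hb (i) : b i = algebraMap B L (b₀ i) :=
    Module.Basis.localizationLocalization_apply K A⁰ L b₀ i
  set d := algebraMap B L δ with hd
  have hdual : FractionalIdeal.dual A K (1 : FractionalIdeal B⁰ L) =
      FractionalIdeal.spanSingleton B⁰ d⁻¹ := by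
    rw [← FractionalIdeal.spanSingleton_inv, ← inv_inv (FractionalIdeal.dual A K 1),
      ← coeIdeal_differentIdeal A K L B, hδ, FractionalIdeal.coeIdeal_span_singleton]
  have hd0 : d ≠ 0 := by
    intro h
    refine FractionalIdeal.dual_ne_zero A K (I := (1 : FractionalIdeal B⁰ L)) one_ne_zero ?_
    rw [hdual, h, inv_zero, FractionalIdeal.spanSingleton_zero]
  have hM (i j) : ∃ m : A, algebraMap A K m = Algebra.trace K L (d⁻¹ * b i * b j) := by
    have h : d⁻¹ ∈ FractionalIdeal.dual A K (1 : FractionalIdeal B⁰ L) := by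
      rw [hdual]; exact FractionalIdeal.mem_spanSingleton_self _ _
    have := (FractionalIdeal.mem_dual (A := A) (K := K) (I := (1 : FractionalIdeal B⁰ L))
      one_ne_zero).1 h (b i * b j)
      ((FractionalIdeal.mem_one_iff _).2 ⟨b₀ i * b₀ j, by simp [hb]⟩)
    simpa [Algebra.traceForm_apply, mul_assoc] using this
  choose M hM using hM
  have hspan : ((1 : Submodule B L).restrictScalars A) = Submodule.span A (Set.range b) := by
    rw [Module.Basis.localizationLocalization_span K A⁰ L b₀]
    ext x
    simp [Submodule.mem_one]
  have hC (i) : ∃ β : B, b.traceDual i = d⁻¹ * algebraMap B L β := by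
    have h : b.traceDual i ∈ (Submodule.traceDual A K (1 : Submodule B L)).restrictScalars A := by
      rw [Submodule.traceDual_span_of_basis A (1 : Submodule B L) b hspan]
      exact Submodule.subset_span ⟨i, rfl⟩
    rw [Submodule.restrictScalars_mem, ← FractionalIdeal.coe_dual_one A K L B,
      FractionalIdeal.mem_coe, hdual, FractionalIdeal.mem_spanSingleton] at h
    obtain ⟨β, hβ⟩ := h
    exact ⟨β, by rw [← hβ, Algebra.smul_def, mul_comm]⟩
  choose β hβ using hC
  have hunit : IsUnit (Matrix.of M).det := by
    have h : (Matrix.of fun i j => b₀.repr (β i) j) * Matrix.of M = 1 := by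
      ext i k
      apply hinjA
      rw [Matrix.mul_apply, map_sum]
      simp only [Matrix.of_apply, map_mul, hM]
      have h1 := b.trace_traceDual_mul i k
      rw [hβ, ← b₀.sum_repr (β i)] at h1
      simp only [map_sum, Finset.mul_sum, Finset.sum_mul] at h1
      rw [Matrix.one_apply]
      simp only [eq_comm (a := i), apply_ite (algebraMap A K), map_one, map_zero]
      rw [← h1]
      refine Finset.sum_congr rfl fun j _ => ?_
      rw [← smul_eq_mul, ← map_smul, hb j, Algebra.smul_def, Algebra.smul_def,
        map_mul (algebraMap B L), ← IsScalarTower.algebraMap_apply A K L,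
        ← IsScalarTower.algebraMap_apply A B L]
      congr 1
      ring
    exact Matrix.isUnit_det_of_left_inverse h
  let Q : Matrix Gal(L/K) Gal(L/K) B := Matrix.of fun σ j => galRestrict A K L B σ (b₀ j)
  have hfac : (Matrix.of M).map (algebraMap A L) = ((algebraMap B L).mapMatrix Q).transpose *
      Matrix.diagonal (fun σ : Gal(L/K) => σ d⁻¹) * (algebraMap B L).mapMatrix Q := by
    ext i j
    rw [Matrix.mul_apply]
    simp only [Matrix.mul_diagonal, Matrix.transpose_apply, RingHom.mapMatrix_apply,
      Matrix.map_apply, Q, Matrix.of_apply, algebraMap_galRestrict_apply]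
    rw [IsScalarTower.algebraMap_apply A K L, hM, trace_eq_sum_automorphisms]
    refine Finset.sum_congr rfl fun σ _ => ?_
    rw [map_mul, map_mul, hb, hb]
    ring
  have hdet : algebraMap A L (Matrix.of M).det * ∏ σ : Gal(L/K), σ d =
      algebraMap B L Q.det ^ 2 := by
    have h := congrArg Matrix.det hfac
    rw [Matrix.det_mul, Matrix.det_mul, Matrix.det_transpose, Matrix.det_diagonal,
      ← RingHom.map_det, ← RingHom.mapMatrix_apply, ← RingHom.map_det] at h
    rw [h]
    have h1 : (∏ σ : Gal(L/K), σ d⁻¹) * ∏ σ : Gal(L/K), σ d = 1 := by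
      rw [← Finset.prod_mul_distrib]
      exact Finset.prod_eq_one fun σ _ => by rw [← map_mul, inv_mul_cancel₀ hd0, map_one]
    linear_combination (algebraMap B L Q.det) ^ 2 * h1
  have hdetB : algebraMap A B (Matrix.of M).det * ∏ σ : Gal(L/K), galRestrict A K L B σ δ =
      Q.det ^ 2 := by
    apply hinj
    rw [map_mul, map_prod, map_pow, ← hdet, ← IsScalarTower.algebraMap_apply]
    simp only [algebraMap_galRestrict_apply, hd]
  have hu : IsUnit (algebraMap A B (Matrix.of M).det) := hunit.map _
  refine ⟨Q.det, ?_, ?_⟩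
  · intro h
    rw [h, zero_pow two_ne_zero, hu.mul_right_eq_zero, Finset.prod_eq_zero_iff] at hdetB
    obtain ⟨σ, -, hσ⟩ := hdetB
    rw [map_eq_zero_iff _ (AlgEquiv.injective _)] at hσ
    exact hd0 (by rw [hd, hσ, map_zero])
  · rw [← hdetB]
    exact associated_unit_mul_right _ _ hu

/-- A ring automorphism of a discrete valuation ring preserves the valuation. -/
theorem IsDiscreteValuationRing.associated_ringEquiv [IsDomain B] [IsDiscreteValuationRing B]
    (e : B ≃+* B) (x : B) : Associated (e x) x := by
  obtain ⟨π, hπ⟩ := IsDiscreteValuationRing.exists_irreducible B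
  have h : Associated (e π) π :=
    IsDiscreteValuationRing.associated_of_irreducible B ((MulEquiv.irreducible_iff e).2 hπ) hπ
  obtain rfl | hx := eq_or_ne x 0
  · simp
  obtain ⟨n, hn⟩ := IsDiscreteValuationRing.associated_pow_irreducible hx hπ
  have hn' : Associated (e x) (e π ^ n) := by simpa using hn.map e
  exact hn'.trans ((h.pow_pow).trans hn.symm)

/-- If `B` is a discrete valuation ring, integral closure of the principal ideal domain `A` in a
Galois extension of odd degree, then the different ideal of `B` over `A` is an even power of the
maximal ideal. -/
theorem differentIdeal_eq_even_pow_maximalIdeal [IsDomain B]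
    [IsDiscreteValuationRing B] [IsFractionRing B L] [Module.IsTorsionFree A B]
    (hodd : Odd (Module.finrank K L)) :
    ∃ k : ℕ, Even k ∧ differentIdeal A B = IsLocalRing.maximalIdeal B ^ k := by
  classical
  obtain ⟨δ, hδ⟩ := IsPrincipalIdealRing.principal (differentIdeal A B)
  rw [Ideal.submodule_span_eq] at hδ
  obtain ⟨P, hP0, hP⟩ := associated_prod_galRestrict_sq (K := K) (L := L) hδ
  obtain ⟨π, hπ⟩ := IsDiscreteValuationRing.exists_irreducible B
  have hpow : Associated (δ ^ Module.finrank K L) (P ^ 2) := by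
    rw [← IsGalois.card_aut_eq_finrank, Nat.card_eq_fintype_card, ← Finset.card_univ,
      ← Finset.prod_const]
    exact (Associated.prod _ _ _ fun σ _ =>
      (IsDiscreteValuationRing.associated_ringEquiv
        (galRestrict A K L B σ).toRingEquiv δ).symm).trans hP
  have hδ0 : δ ≠ 0 := by
    rintro rfl
    rw [zero_pow hodd.pos.ne', Associated.comm, associated_zero_iff_eq_zero] at hpow
    exact hP0 (pow_eq_zero_iff two_ne_zero |>.1 hpow)
  obtain ⟨k, hk⟩ := IsDiscreteValuationRing.associated_pow_irreducible hδ0 hπ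
  obtain ⟨l, hl⟩ := IsDiscreteValuationRing.associated_pow_irreducible hP0 hπ
  refine ⟨k, ?_, ?_⟩
  · have h : Associated (π ^ (k * Module.finrank K L)) (π ^ (l * 2)) := by
      rw [pow_mul, pow_mul]
      exact hk.symm.pow_pow.trans (hpow.trans hl.pow_pow)
    have h' := (IsDiscreteValuationRing.addVal_eq_iff_associated _ _).2 h
    rw [hπ.addVal_pow, hπ.addVal_pow, Nat.cast_inj] at h'
    have h2 : Even (k * Module.finrank K L) := h' ▸ even_two.mul_left l
    exact (Nat.even_mul.1 h2).resolve_right (Nat.not_even_iff_odd.2 hodd)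
  · rw [hδ, hπ.maximalIdeal_eq, Ideal.span_singleton_pow, Ideal.span_singleton_eq_span_singleton]
    exact hk

end Discriminant

/-- Squaring is injective on fractional ideals of a Dedekind domain. -/
theorem FractionalIdeal.eq_of_sq_eq_sq {R K : Type*} [CommRing R] [IsDedekindDomain R] [Field K]
    [Algebra R K] [IsFractionRing R K] {I J : FractionalIdeal R⁰ K} (h : I ^ 2 = J ^ 2) :
    I = J := by
  obtain ⟨a, I', ha, rfl⟩ := FractionalIdeal.exists_eq_spanSingleton_mul I
  obtain ⟨c, J', hc, rfl⟩ := FractionalIdeal.exists_eq_spanSingleton_mul J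
  have ha' : algebraMap R K a ≠ 0 := by simpa using ha
  have hc' : algebraMap R K c ≠ 0 := by simpa using hc
  set a' := spanSingleton R⁰ (algebraMap R K a) with ha_def
  set c' := spanSingleton R⁰ (algebraMap R K c) with hc_def
  have haa : a' * spanSingleton R⁰ (algebraMap R K a)⁻¹ = 1 := by
    rw [spanSingleton_mul_spanSingleton, mul_inv_cancel₀ ha', spanSingleton_one]
  have hcc : c' * spanSingleton R⁰ (algebraMap R K c)⁻¹ = 1 := by
    rw [spanSingleton_mul_spanSingleton, mul_inv_cancel₀ hc', spanSingleton_one]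
  have hI : c' * I' = (a' * c') * (spanSingleton R⁰ (algebraMap R K a)⁻¹ * I') := by
    rw [← one_mul (c' * _), ← haa]; ring
  have hJ : a' * J' = (a' * c') * (spanSingleton R⁰ (algebraMap R K c)⁻¹ * J') := by
    rw [← one_mul (a' * _), ← hcc]; ring
  have hsq : (Ideal.span {c} * I') ^ 2 = (Ideal.span {a} * J') ^ 2 := by
    rw [← FractionalIdeal.coeIdeal_inj (K := K)]
    simp only [coeIdeal_pow, coeIdeal_mul, coeIdeal_span_singleton]
    rw [← ha_def, ← hc_def, hI, hJ, mul_pow, h, ← mul_pow]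
  have heq : Ideal.span {c} * I' = Ideal.span {a} * J' :=
    dvd_antisymm ((UniqueFactorizationMonoid.pow_dvd_pow_iff_dvd two_ne_zero).1 hsq.dvd)
      ((UniqueFactorizationMonoid.pow_dvd_pow_iff_dvd two_ne_zero).1 hsq.symm.dvd)
  have heq' := congrArg (fun I : Ideal R => (I : FractionalIdeal R⁰ K)) heq
  simp only [coeIdeal_mul, coeIdeal_span_singleton] at heq'
  rw [← ha_def, ← hc_def, hI, hJ] at heq'
  exact mul_left_cancel₀ (mul_ne_zero (left_ne_zero_of_mul_eq_one haa)
    (left_ne_zero_of_mul_eq_one hcc)) heq'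

theorem isPrincipalIdealRing_of_isLocalRing (R : Type*) [CommRing R] [IsDedekindDomain R]
    [IsLocalRing R] : IsPrincipalIdealRing R :=
  .of_finite_maximals <| (Set.finite_singleton (IsLocalRing.maximalIdeal R)).subset
    fun _ hI => IsLocalRing.eq_maximalIdeal hI

/-- Let `E/F` be a finite Galois extension of `p`-adic fields of odd degree,
with rings of integers `O_F ⊆ O_E` (the integral closures of `ℤ_p`). Then the valuation
`v_E(𝔇_{E/F})` of the different ideal is even, i.e. `𝔇_{E/F}` is an even power of the maximal
ideal of `O_E`; equivalently, there is a unique fractional ideal `A` of `O_E` with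
`A ^ 2 = (𝔇_{E/F})⁻¹`. -/
theorem differentIdeal_isEvenPow_of_odd_degree
    (p : ℕ) [Fact p.Prime] (F E : Type) [Field F] [Field E]
    [Algebra ℚ_[p] F] [FiniteDimensional ℚ_[p] F]
    [Algebra ℚ_[p] E] [FiniteDimensional ℚ_[p] E]
    [Algebra ℤ_[p] F] [IsScalarTower ℤ_[p] ℚ_[p] F]
    [Algebra ℤ_[p] E] [IsScalarTower ℤ_[p] ℚ_[p] E]
    [Algebra F E] [IsScalarTower ℚ_[p] F E] [FiniteDimensional F E] [IsGalois F E]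
    (hodd : Odd (Module.finrank F E))
    [Algebra (integralClosure ℤ_[p] F) (integralClosure ℤ_[p] E)]
    (hcomp : ∀ x : integralClosure ℤ_[p] F,
      ((algebraMap (integralClosure ℤ_[p] F) (integralClosure ℤ_[p] E) x : E)) =
        algebraMap F E (x : F))
    [IsDedekindDomain (integralClosure ℤ_[p] E)]
    [NoZeroSMulDivisors (integralClosure ℤ_[p] F) (integralClosure ℤ_[p] E)]
    [IsLocalRing (integralClosure ℤ_[p] E)]
    [IsFractionRing (integralClosure ℤ_[p] E) E] :
    (∃ k : ℕ, Even k ∧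
      differentIdeal (integralClosure ℤ_[p] F) (integralClosure ℤ_[p] E) =
        (IsLocalRing.maximalIdeal (integralClosure ℤ_[p] E)) ^ k) ∧
    (∃! A : FractionalIdeal (integralClosure ℤ_[p] E)⁰ E,
      A ^ 2 = (differentIdeal (integralClosure ℤ_[p] F) (integralClosure ℤ_[p] E) :
        FractionalIdeal (integralClosure ℤ_[p] E)⁰ E)⁻¹) := by
  have : IsScalarTower ℤ_[p] F E := .of_algebraMap_eq fun x => by
    rw [IsScalarTower.algebraMap_apply ℤ_[p] ℚ_[p] E, IsScalarTower.algebraMap_apply ℚ_[p] F E,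
      ← IsScalarTower.algebraMap_apply ℤ_[p] ℚ_[p] F]
  have : IsScalarTower (integralClosure ℤ_[p] F) (integralClosure ℤ_[p] E) E :=
    .of_algebraMap_eq fun x => (hcomp x).symm
  have : IsIntegralClosure (integralClosure ℤ_[p] E) (integralClosure ℤ_[p] F) E :=
    IsIntegralClosure.tower_top (R := ℤ_[p])
  have : IsFractionRing (integralClosure ℤ_[p] F) F :=
    integralClosure.isFractionRing_of_finite_extension ℚ_[p] F
  have : IsDedekindDomain (integralClosure ℤ_[p] F) :=
    integralClosure.isDedekindDomain ℤ_[p] ℚ_[p] F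
  have : Algebra.IsIntegral (integralClosure ℤ_[p] F) (integralClosure ℤ_[p] E) :=
    IsIntegralClosure.isIntegral_algebra _ E
  have : IsLocalRing (integralClosure ℤ_[p] F) :=
    (algebraMap (integralClosure ℤ_[p] F) (integralClosure ℤ_[p] E)).domain_isLocalRing
  have : IsPrincipalIdealRing (integralClosure ℤ_[p] F) := isPrincipalIdealRing_of_isLocalRing _
  have : IsPrincipalIdealRing (integralClosure ℤ_[p] E) := isPrincipalIdealRing_of_isLocalRing _
  have : FaithfulSMul ℤ_[p] E := by
    rw [faithfulSMul_iff_algebraMap_injective, IsScalarTower.algebraMap_eq ℤ_[p] ℚ_[p] E]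
    exact (algebraMap ℚ_[p] E).injective.comp (FaithfulSMul.algebraMap_injective _ _)
  have hfield : ¬ IsField (integralClosure ℤ_[p] E) := by
    rw [← Algebra.IsIntegral.isField_iff_isField (R := ℤ_[p])
      (FaithfulSMul.algebraMap_injective _ _)]
    exact IsDiscreteValuationRing.not_isField ℤ_[p]
  have : IsDiscreteValuationRing (integralClosure ℤ_[p] E) :=
    { not_a_field' := fun h => hfield (IsLocalRing.isField_iff_maximalIdeal_eq.2 h) }
  obtain ⟨k, hk, hD⟩ := differentIdeal_eq_even_pow_maximalIdeal
    (A := integralClosure ℤ_[p] F) (K := F) (L := E) (B := integralClosure ℤ_[p] E) hodd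
  refine ⟨⟨k, hk, hD⟩, ?_⟩
  obtain ⟨m, rfl⟩ := hk
  refine ⟨((IsLocalRing.maximalIdeal (integralClosure ℤ_[p] E) :
    FractionalIdeal (integralClosure ℤ_[p] E)⁰ E) ^ m)⁻¹, ?_, fun A hA => ?_⟩
  · simp only [hD, FractionalIdeal.coeIdeal_pow]
    rw [inv_pow, ← pow_mul, mul_two]
  · apply FractionalIdeal.eq_of_sq_eq_sq
    rw [hA, hD, FractionalIdeal.coeIdeal_pow, inv_pow, ← pow_mul, mul_two]
end
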